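/- Define S_n = ((7n²-3n-2)/2)·(-1)^{n-1} + 3·Σ_{i=2}^{n} 2^{i+1}·(2i-4)!/(i!(i-2)!)·C(n-i+2,2)·(-1)^{n-i} and T_n = 2·Σ_{k=0}^{n} C(2k,k)·C(n,k)²·(3k²+2k+1-n-2kn)/((k+1)²(k+2)(n-k+1)). Then for all n ≥ 6, S_n < T_n. -/

import Mathlib

open Finset

/-- The exact formula for `S_n(1342)`. -/
def S1342 (n : ℕ) : ℚ :=
  ((7 * (n : ℚ) ^ 2 - 3 * n - 2) / 2) * (-1) ^ (n - 1) +
    3 * ∑ i ∈ Finset.Icc 2 n,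
      2 ^ (i + 1) * (Nat.factorial (2 * i - 4) : ℚ) /
        (Nat.factorial i * Nat.factorial (i - 2)) *
        (Nat.choose (n - i + 2) 2) * (-1) ^ (n - i)

/-- Gessel's exact formula for `S_n(1234)`. -/
def S1234 (n : ℕ) : ℚ :=
  2 * ∑ k ∈ Finset.range (n + 1),
    (Nat.choose (2 * k) k : ℚ) * (Nat.choose n k : ℚ) ^ 2 *
      (3 * (k : ℚ) ^ 2 + 2 * k + 1 - n - 2 * k * n) /
        (((k : ℚ) + 1) ^ 2 * ((k : ℚ) + 2) * ((n : ℚ) - k + 1))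

/-- The product of binomial coefficients through which Gessel's sum is expressed. -/
def kernel (n k : ℕ) : ℚ :=
  (Nat.choose (2 * k) k : ℚ) * Nat.choose (n + 2) (k + 2) * Nat.choose (n + 2) (k + 1) /
    (((n : ℚ) + 1) ^ 2 * ((n : ℚ) + 2) ^ 2)

theorem kernel_eq_zero {n k : ℕ} (h : n < k) : kernel n k = 0 := by
  simp [kernel, Nat.choose_eq_zero_of_lt (show n + 2 < k + 2 by omega)]

theorem choose_succ_left_mul (n k : ℕ) :
    ((n : ℚ) + 1) * Nat.choose n k = Nat.choose (n + 1) k * ((n : ℚ) + 1 - k) := by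
  rcases le_or_gt k (n + 1) with h | h
  · have := Nat.choose_mul_succ_eq n k
    have h2 : ((n + 1 - k : ℕ) : ℚ) = (n : ℚ) + 1 - k := by push_cast [Nat.cast_sub h]; ring
    rw [← h2]
    exact_mod_cast (mul_comm _ _).trans this
  · simp [Nat.choose_eq_zero_of_lt h, Nat.choose_eq_zero_of_lt (show n < k by omega)]

theorem choose_succ_right_mul (n k : ℕ) :
    (Nat.choose n (k + 1) : ℚ) * ((k : ℚ) + 1) = Nat.choose n k * ((n : ℚ) - k) := by
  rcases le_or_gt k n with h | h
  · have := Nat.choose_succ_right_eq n k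
    rw [← Nat.cast_sub h]
    exact_mod_cast this
  · simp [Nat.choose_eq_zero_of_lt h, Nat.choose_eq_zero_of_lt (show n < k + 1 by omega)]

theorem kernel_succ_left (n k : ℕ) :
    kernel n k * ((n : ℚ) + 1) ^ 2 =
      kernel (n + 1) k * (((n : ℚ) + 1 - k) * ((n : ℚ) + 2 - k)) := by
  have h1 := choose_succ_left_mul (n + 2) (k + 2)
  have h2 := choose_succ_left_mul (n + 2) (k + 1)
  push_cast at h1 h2
  have e1 : (Nat.choose (n + 2) (k + 2) : ℚ) =
      Nat.choose (n + 3) (k + 2) * ((n : ℚ) + 1 - k) / ((n : ℚ) + 3) := by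
    rw [eq_div_iff (by positivity)]; linear_combination h1
  have e2 : (Nat.choose (n + 2) (k + 1) : ℚ) =
      Nat.choose (n + 3) (k + 1) * ((n : ℚ) + 2 - k) / ((n : ℚ) + 3) := by
    rw [eq_div_iff (by positivity)]; linear_combination h2
  rw [kernel, kernel, e1, e2]
  push_cast
  rw [show n + 1 + 2 = n + 3 by rfl, show (n : ℚ) + 1 + 1 = n + 2 by ring,
    show (n : ℚ) + 1 + 2 = n + 3 by ring]
  field_simp

theorem kernel_succ_right (n k : ℕ) :
    kernel n (k + 1) * (((k : ℚ) + 1) * ((k : ℚ) + 2) * ((k : ℚ) + 3)) =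
      kernel n k * (2 * (2 * (k : ℚ) + 1) * ((n : ℚ) - k) * ((n : ℚ) + 1 - k)) := by
  have h1 := choose_succ_right_mul (n + 2) (k + 2)
  have h2 := choose_succ_right_mul (n + 2) (k + 1)
  have h3 : ((k : ℚ) + 1) * Nat.choose (2 * (k + 1)) (k + 1) =
      2 * (2 * (k : ℚ) + 1) * Nat.choose (2 * k) k := by
    exact_mod_cast Nat.succ_mul_centralBinom_succ k
  push_cast at h1 h2
  have e1 : (Nat.choose (n + 2) (k + 2 + 1) : ℚ) =
      Nat.choose (n + 2) (k + 2) * ((n : ℚ) - k) / ((k : ℚ) + 3) := by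
    rw [eq_div_iff (by positivity)]; linear_combination h1
  have e2 : (Nat.choose (n + 2) (k + 1 + 1) : ℚ) =
      Nat.choose (n + 2) (k + 1) * ((n : ℚ) + 1 - k) / ((k : ℚ) + 2) := by
    rw [eq_div_iff (by positivity)]; linear_combination h2
  have e3 : (Nat.choose (2 * (k + 1)) (k + 1) : ℚ) =
      2 * (2 * (k : ℚ) + 1) * Nat.choose (2 * k) k / ((k : ℚ) + 1) := by
    rw [eq_div_iff (by positivity)]; linear_combination h3
  rw [kernel, kernel, show k + 1 + 2 = k + 2 + 1 by rfl, e1, e3,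
    show Nat.choose (n + 2) (k + 2) = Nat.choose (n + 2) (k + 1 + 1) by rfl, e2]
  field_simp

/-- Weighted sums of the kernel over its support. -/
def kernelSum (n : ℕ) (w : ℕ → ℚ) : ℚ := ∑ k ∈ range (n + 1), kernel n k * w k

theorem kernelSum_eq_sum_range {n m : ℕ} (h : n < m) (w : ℕ → ℚ) :
    kernelSum n w = ∑ k ∈ range m, kernel n k * w k := by
  apply sum_subset (range_subset_range.2 h)
  intro k _ hk
  rw [kernel_eq_zero (by simpa using hk), zero_mul]

theorem kernelSum_telescope (n : ℕ) (q : ℕ → ℚ) :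
    kernelSum n (fun k => 2 * (2 * (k : ℚ) + 1) * ((n : ℚ) - k) * ((n : ℚ) + 1 - k) * q (k + 1) -
      (k : ℚ) * ((k : ℚ) + 1) * ((k : ℚ) + 2) * q k) = 0 := by
  have h := Finset.sum_range_sub
    (fun k => kernel n k * ((k : ℚ) * ((k : ℚ) + 1) * ((k : ℚ) + 2)) * q k) (n + 1)
  rw [kernel_eq_zero (Nat.lt_succ_self n)] at h
  simp only [CharP.cast_eq_zero, zero_mul, mul_zero, sub_zero] at h
  rw [kernelSum, ← h]
  refine sum_congr rfl fun k _ => ?_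
  push_cast
  linear_combination -q (k + 1) * kernel_succ_right n k

theorem kernelSum_succ (n : ℕ) (w : ℕ → ℚ) :
    ((n : ℚ) + 1) ^ 2 * kernelSum n w =
      kernelSum (n + 1) (fun k => ((n : ℚ) + 1 - k) * ((n : ℚ) + 2 - k) * w k) := by
  rw [kernelSum_eq_sum_range (show n < n + 1 + 1 by omega), kernelSum, mul_sum]
  refine sum_congr rfl fun k _ => ?_
  linear_combination w k * kernel_succ_left n k

theorem kernelSum_add (n : ℕ) (v w : ℕ → ℚ) :
    kernelSum n (fun k => v k + w k) = kernelSum n v + kernelSum n w := by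
  simp [kernelSum, mul_add, sum_add_distrib]

/-- The difference between the weight in Gessel's formula and the weight `k + 2`. -/
def excess (n k : ℕ) : ℚ :=
  2 * (3 * (k : ℚ) ^ 2 + 2 * k + 1 - n - 2 * k * n) - (k + 2)

theorem kernelSum_excess_succ (n : ℕ) :
    ((n : ℚ) + 2) * ((n : ℚ) + 3) * kernelSum (n + 1) (excess (n + 1)) =
      ((n : ℚ) + 1) ^ 2 * kernelSum n (excess n) := by
  have h := kernelSum_telescope (n + 1) (fun k => -(2 * (k : ℚ) + 1))
  rw [kernelSum_succ, ← sub_eq_zero, ← h]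
  simp only [kernelSum, mul_sum, ← sum_sub_distrib]
  refine sum_congr rfl fun k _ => ?_
  simp only [excess]
  push_cast
  ring

theorem kernelSum_excess (n : ℕ) : kernelSum n (excess n) = 0 := by
  induction n with
  | zero => norm_num [kernelSum, excess]
  | succ n ih =>
    have h := kernelSum_excess_succ n
    rw [ih, mul_zero] at h
    exact (mul_eq_zero.1 h).resolve_left (by positivity)

theorem S1234_eq_kernelSum (n : ℕ) : S1234 n = kernelSum n (fun k => (k : ℚ) + 2) := by
  have h := kernelSum_excess n
  rw [S1234, ← add_zero (kernelSum n _), ← h, ← kernelSum_add, kernelSum, mul_sum]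
  refine sum_congr rfl fun k hk => ?_
  have hk' : (k : ℚ) ≤ n := by exact_mod_cast Nat.lt_succ_iff.1 (mem_range.1 hk)
  have h1 := choose_succ_left_mul n k
  have h2 : ((n : ℚ) + 1) * Nat.choose n k = Nat.choose (n + 1) (k + 1) * ((k : ℚ) + 1) := by
    exact_mod_cast Nat.add_one_mul_choose_eq n k
  have h3 : ((n : ℚ) + 2) * Nat.choose (n + 1) k = Nat.choose (n + 2) (k + 1) * ((k : ℚ) + 1) := by
    exact_mod_cast Nat.add_one_mul_choose_eq (n + 1) k
  have h4 : ((n : ℚ) + 2) * Nat.choose (n + 1) (k + 1) =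
      Nat.choose (n + 2) (k + 2) * ((k : ℚ) + 2) := by
    exact_mod_cast Nat.add_one_mul_choose_eq (n + 1) (k + 1)
  have hd : (n : ℚ) - k + 1 ≠ 0 := by linarith
  have e1 : (Nat.choose (n + 2) (k + 2) : ℚ) =
      ((n : ℚ) + 2) * ((n : ℚ) + 1) * Nat.choose n k / (((k : ℚ) + 1) * ((k : ℚ) + 2)) := by
    rw [eq_div_iff (by positivity)]
    linear_combination -((k : ℚ) + 1) * h4 - ((n : ℚ) + 2) * h2
  have e2 : (Nat.choose (n + 2) (k + 1) : ℚ) =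
      ((n : ℚ) + 2) * ((n : ℚ) + 1) * Nat.choose n k / (((k : ℚ) + 1) * ((n : ℚ) - k + 1)) := by
    rw [eq_div_iff (by positivity)]
    linear_combination -((n : ℚ) - k + 1) * h3 - ((n : ℚ) + 2) * h1
  rw [kernel, e1, e2, excess]
  field_simp
  ring

theorem S1234_recurrence (n : ℕ) :
    ((n : ℚ) + 4) ^ 2 * S1234 (n + 2) =
      (10 * (n : ℚ) ^ 2 + 42 * n + 41) * S1234 (n + 1) - 9 * ((n : ℚ) + 1) ^ 2 * S1234 n := by
  set q : ℕ → ℚ := fun k =>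
    -((17 + 11 * (n : ℚ) + 2 * n ^ 2) * (n + 2) * (n + 3)
      + (223 + 341 * (n : ℚ) + 188 * n ^ 2 + 45 * n ^ 3 + 4 * n ^ 4) * k
      - (117 + 109 * (n : ℚ) + 32 * n ^ 2 + 3 * n ^ 3) * k ^ 2
      + (14 + 4 * (n : ℚ)) * k ^ 3) with hq
  have h := kernelSum_telescope (n + 2) q
  have hD := kernelSum_excess n
  have a1 (w : ℕ → ℚ) := kernelSum_succ (n + 1) w
  have a0 (w : ℕ → ℚ) := kernelSum_succ n w
  push_cast at a1
  have key : ((n : ℚ) + 2) ^ 3 * ((n : ℚ) + 3) ^ 2 *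
      (((n : ℚ) + 4) ^ 2 * S1234 (n + 2) - (10 * (n : ℚ) ^ 2 + 42 * n + 41) * S1234 (n + 1)
        + 9 * ((n : ℚ) + 1) ^ 2 * S1234 n)
      - (n + 2) ^ 2 * ((n : ℚ) + 1) ^ 2 * (2 * n + 7) * kernelSum n (excess n) = 0 := by
    rw [← h]
    have b1 := a1 (fun k => (k : ℚ) + 2)
    have b0 := a1 (fun k => ((n : ℚ) + 1 - k) * ((n : ℚ) + 2 - k) * ((k : ℚ) + 2))
    have bD := a1 (fun k => ((n : ℚ) + 1 - k) * ((n : ℚ) + 2 - k) * excess n k)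
    rw [← a0, ← S1234_eq_kernelSum] at b0
    rw [← a0] at bD
    rw [← S1234_eq_kernelSum] at b1
    have e : ∀ X Y Z W : ℚ, ((n : ℚ) + 2) ^ 3 * ((n : ℚ) + 3) ^ 2 *
      (((n : ℚ) + 4) ^ 2 * X - (10 * (n : ℚ) ^ 2 + 42 * n + 41) * Y
        + 9 * ((n : ℚ) + 1) ^ 2 * Z)
      - (n + 2) ^ 2 * ((n : ℚ) + 1) ^ 2 * (2 * n + 7) * W =
      ((n : ℚ) + 2) ^ 3 * ((n : ℚ) + 3) ^ 2 * ((n : ℚ) + 4) ^ 2 * X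
      - (n + 2) * (n + 3) ^ 2 * (10 * (n : ℚ) ^ 2 + 42 * n + 41) * ((n + 1 + 1) ^ 2 * Y)
      + 9 * (n + 2) * (n + 3) ^ 2 * ((n + 1 + 1) ^ 2 * ((n + 1) ^ 2 * Z))
      - (2 * n + 7) * ((n + 1 + 1) ^ 2 * ((n + 1) ^ 2 * W)) := by intros; ring
    rw [e, b1, b0, bD, S1234_eq_kernelSum]
    simp only [kernelSum, mul_sum, ← sum_sub_distrib, ← sum_add_distrib]
    refine sum_congr rfl fun k _ => ?_
    simp only [excess, hq]
    push_cast
    ring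
  rw [hD, mul_zero, sub_zero] at key
  have := (mul_eq_zero.1 key).resolve_left (by positivity)
  linarith

/-- The weights in the sum defining `S1342`. -/
def weight (i : ℕ) : ℚ :=
  2 ^ (i + 1) * (Nat.factorial (2 * i - 4) : ℚ) / (Nat.factorial i * Nat.factorial (i - 2))

theorem weight_pos (i : ℕ) : 0 < weight i := by
  unfold weight; positivity

theorem weight_succ {i : ℕ} (hi : 2 ≤ i) :
    weight (i + 1) * ((i : ℚ) + 1) = 4 * (2 * (i : ℚ) - 3) * weight i := by
  obtain ⟨j, rfl⟩ := Nat.exists_eq_add_of_le' hi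
  have h1 : 2 * (j + 2 + 1) - 4 = 2 * j + 1 + 1 := by omega
  have h2 : 2 * (j + 2) - 4 = 2 * j := by omega
  have h3 : j + 2 + 1 - 2 = j + 1 := by omega
  have h4 : j + 2 - 2 = j := by omega
  simp only [weight, h1, h2, h3, h4, Nat.factorial_succ]
  push_cast
  field_simp
  ring

theorem six_mul_weight_le {i : ℕ} (hi : 9 ≤ i) : 6 * weight i ≤ weight (i + 1) := by
  have h := weight_succ (show 2 ≤ i by omega)
  have hi' : (9 : ℚ) ≤ i := by exact_mod_cast hi
  have hw := weight_pos i
  refine le_of_mul_le_mul_right (a := (i : ℚ) + 1) ?_ (by positivity)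
  rw [h]
  nlinarith

theorem choose_two_le_three_pow (m : ℕ) : Nat.choose (m + 2) 2 ≤ 3 ^ m := by
  induction m with
  | zero => simp
  | succ m ih =>
    have h : Nat.choose (m + 1 + 2) 2 = Nat.choose (m + 2) 2 + (m + 2) := by
      rw [Nat.choose_succ_succ' (m + 2) 1, Nat.choose_one_right, add_comm]
    have h' : m + 2 ≤ 2 * Nat.choose (m + 2) 2 := by
      rw [Nat.choose_two_right]
      have := Nat.div_mul_cancel (Nat.even_mul_pred_self (m + 2)).two_dvd
      rw [mul_comm 2, this]
      exact Nat.le_mul_of_pos_right _ (by omega)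
    rw [h, pow_succ]
    omega

/-- A sum dominating the alternating sum defining `S1342`. -/
def dominating (n : ℕ) : ℚ := ∑ i ∈ Finset.Icc 2 n, weight i * 3 ^ (n - i)

theorem dominating_succ {n : ℕ} (hn : 1 ≤ n) :
    dominating (n + 1) = 3 * dominating n + weight (n + 1) := by
  rw [dominating, Finset.sum_Icc_succ_top (by omega), dominating, mul_sum]
  simp only [Nat.sub_self, pow_zero, mul_one]
  congr 1
  refine sum_congr rfl fun i hi => ?_
  rw [Nat.succ_sub (mem_Icc.1 hi).2, pow_succ]
  ring

theorem S1342_le (n : ℕ) : S1342 n ≤ 4 * (n : ℚ) ^ 2 + 2 + 3 * dominating n := by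
  rw [S1342]
  have hp : ((7 * (n : ℚ) ^ 2 - 3 * n - 2) / 2) * (-1) ^ (n - 1) ≤ 4 * (n : ℚ) ^ 2 + 2 := by
    have hn : (0 : ℚ) ≤ n := n.cast_nonneg
    rcases neg_one_pow_eq_or ℚ (n - 1) with h | h <;> rw [h]
    · nlinarith
    · nlinarith [sq_nonneg ((n : ℚ) - 1)]
  have hs : ∀ i ∈ Finset.Icc 2 n, 2 ^ (i + 1) * (Nat.factorial (2 * i - 4) : ℚ) /
        (Nat.factorial i * Nat.factorial (i - 2)) *
        (Nat.choose (n - i + 2) 2) * (-1) ^ (n - i) ≤ weight i * 3 ^ (n - i) := by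
    intro i _
    have hw := weight_pos i
    have hc : (Nat.choose (n - i + 2) 2 : ℚ) ≤ 3 ^ (n - i) := by
      exact_mod_cast choose_two_le_three_pow (n - i)
    change weight i * _ * _ ≤ _
    have hc0 : (0 : ℚ) ≤ Nat.choose (n - i + 2) 2 := Nat.cast_nonneg _
    have hm := mul_le_mul_of_nonneg_left hc hw.le
    have hm0 := mul_nonneg hw.le hc0
    rcases neg_one_pow_eq_or ℚ (n - i) with h | h <;> rw [h] <;> linarith
  have := sum_le_sum hs
  rw [dominating]
  linarith

theorem dominating_le {n : ℕ} (hn : 32 ≤ n) : dominating n ≤ 2 * weight n := by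
  induction n, hn using Nat.le_induction with
  | base => decide +kernel
  | succ n hn ih =>
    have h := six_mul_weight_le (show 9 ≤ n by omega)
    rw [dominating_succ (by omega)]
    linarith

theorem four_mul_sq_lt_weight {n : ℕ} (hn : 32 ≤ n) : 4 * (n : ℚ) ^ 2 + 2 < weight n := by
  induction n, hn using Nat.le_induction with
  | base => decide +kernel
  | succ n hn ih =>
    have h := six_mul_weight_le (show 9 ≤ n by omega)
    have hn' : (32 : ℚ) ≤ n := by exact_mod_cast hn
    push_cast
    nlinarith

theorem S1342_lt {n : ℕ} (hn : 32 ≤ n) : S1342 n < 7 * weight n := by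
  linarith [S1342_le n, dominating_le hn, four_mul_sq_lt_weight hn]

theorem S1234_pos (n : ℕ) : 0 < S1234 n := by
  rw [S1234_eq_kernelSum, kernelSum]
  refine sum_pos (fun k hk => ?_) ⟨0, by simp⟩
  have hk' : k ≤ n := Nat.lt_succ_iff.1 (mem_range.1 hk)
  have h1 := Nat.choose_pos (show k ≤ 2 * k by omega)
  have h2 := Nat.choose_pos (show k + 2 ≤ n + 2 by omega)
  have h3 := Nat.choose_pos (show k + 1 ≤ n + 2 by omega)
  unfold kernel
  positivity

theorem S1234_succ_ge {n : ℕ} (hn : 6 ≤ n) :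
    4 * (2 * (n : ℚ) - 3) * S1234 n ≤ S1234 (n + 1) * ((n : ℚ) + 1) := by
  induction n, hn using Nat.le_induction with
  | base => decide +kernel
  | succ n hn ih =>
    have hr := S1234_recurrence n
    have hp := S1234_pos (n + 1)
    obtain ⟨m, rfl⟩ := Nat.exists_eq_add_of_le' hn
    push_cast at *
    have hm : (0 : ℚ) ≤ m := m.cast_nonneg
    generalize S1234 (m + 6) = x at *
    generalize S1234 (m + 6 + 1) = y at *
    rw [show m + 6 + 1 + 1 = m + 6 + 2 by rfl]
    generalize S1234 (m + 6 + 2) = z at *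
    have hc : (0 : ℚ) < 4 * (2 * ((m : ℚ) + 6) - 3) * ((m : ℚ) + 6 + 4) ^ 2 := by
      have : (0 : ℚ) < 2 * ((m : ℚ) + 6) - 3 := by linarith
      positivity
    refine le_of_mul_le_mul_right (a := 4 * (2 * ((m : ℚ) + 6) - 3) * ((m : ℚ) + 6 + 4) ^ 2) ?_ hc
    have h1 := mul_le_mul_of_nonneg_left ih
      (show (0 : ℚ) ≤ 9 * ((m : ℚ) + 6 + 1) ^ 2 * ((m : ℚ) + 6 + 2) by positivity)
    have h2 : (0 : ℚ) ≤ y * (4 * (2 * ((m : ℚ) + 6) - 3) * ((m : ℚ) + 6 + 2) *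
        (10 * ((m : ℚ) + 6) ^ 2 + 42 * (m + 6) + 41) - 9 * ((m : ℚ) + 6 + 1) ^ 3 * ((m : ℚ) + 6 + 2)
        - 16 * (2 * ((m : ℚ) + 6) - 3) * (2 * ((m : ℚ) + 6 + 1) - 3) * ((m : ℚ) + 6 + 4) ^ 2) := by
      refine mul_nonneg hp.le ?_
      ring_nf
      positivity
    linear_combination h1 + h2 - 4 * (2 * ((m : ℚ) + 6) - 3) * ((m : ℚ) + 6 + 2) * hr

theorem le_S1234 {n : ℕ} (hn : 32 ≤ n) : 7 * weight n ≤ S1234 n := by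
  induction n, hn using Nat.le_induction with
  | base => decide +kernel
  | succ n hn ih =>
    have h := S1234_succ_ge (show 6 ≤ n by omega)
    have hw := weight_succ (show 2 ≤ n by omega)
    have hn' : (32 : ℚ) ≤ n := by exact_mod_cast hn
    refine le_of_mul_le_mul_right (a := (n : ℚ) + 1) ?_ (by positivity)
    have := mul_le_mul_of_nonneg_left ih (show (0 : ℚ) ≤ 4 * (2 * (n : ℚ) - 3) by linarith)
    linarith

theorem S1342_lt_S1234 (n : ℕ) (hn : 6 ≤ n) : S1342 n < S1234 n := by
  rcases lt_or_ge n 32 with h | h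
  · interval_cases n <;> decide +kernel
  · exact (S1342_lt h).trans_le (le_S1234 h)
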